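/- For any positive integers r ≤ t and any real number γ > 0 there exists a constant c = c_{r,t}(γ) such that every simple graph G on n vertices with more than c · n^{2 - 1/r} edges contains at least γ · C(n, r) copies of the complete bipartite graph K_{r,t} (where C(n,r) denotes the binomial coefficient n choose r). -/

import Mathlib

open Finset

/-- The number of copies of the complete bipartite graph `K_{r,t}` in `G`, counted as
ordered pairs `(R, S)` of disjoint vertex sets with `|R| = r`, `|S| = t` and every
vertex of `R` adjacent to every vertex of `S`.  For `r < t` this is exactly the number
of (unordered) copies of `K_{r,t}` in `G`; for `r = t` each unordered copy is counted
exactly twice. -/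
def ktCopies (r t : ℕ) {n : ℕ} (G : SimpleGraph (Fin n)) [DecidableRel G.Adj] : ℕ :=
  ((Finset.univ.powersetCard r ×ˢ Finset.univ.powersetCard t).filter
    (fun p => Disjoint p.1 p.2 ∧ ∀ a ∈ p.1, ∀ b ∈ p.2, G.Adj a b)).card

/-- The common neighbourhood of a set of vertices. -/
def commonNbrs {n : ℕ} (G : SimpleGraph (Fin n)) [DecidableRel G.Adj]
    (R : Finset (Fin n)) : Finset (Fin n) :=
  univ.filter fun b => ∀ a ∈ R, G.Adj a b

theorem sub_le_choose (m t : ℕ) (ht : 1 ≤ t) : m ≤ m.choose t + t := by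
  induction m with
  | zero => simp
  | succ m ih =>
    by_cases h : m + 1 ≤ t
    · omega
    · obtain ⟨s, rfl⟩ : ∃ s, t = s + 1 := ⟨t - 1, by omega⟩
      have := Nat.choose_pos (n := m) (k := s) (by omega)
      rw [Nat.choose_succ_succ']
      omega

theorem ktCopies_eq_sum_choose (r t : ℕ) {n : ℕ} (G : SimpleGraph (Fin n))
    [DecidableRel G.Adj] :
    ktCopies r t G = ∑ R ∈ univ.powersetCard r, (commonNbrs G R).card.choose t := by
  rw [ktCopies, card_filter, sum_product]
  refine sum_congr rfl fun R hR => ?_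
  rw [← card_filter, ← card_powersetCard]
  congr 1
  ext S
  simp only [mem_filter, mem_powersetCard, subset_univ, true_and]
  constructor
  · rintro ⟨hS, -, h⟩
    refine ⟨fun b hb => ?_, hS⟩
    simpa [commonNbrs] using fun a ha => h a ha b hb
  · rintro ⟨h, hS⟩
    have hadj : ∀ a ∈ R, ∀ b ∈ S, G.Adj a b := fun a ha b hb =>
      (mem_filter.1 (h hb)).2 a ha
    exact ⟨hS, disjoint_left.2 fun a ha hb => G.loopless.irrefl a (hadj a ha a hb), hadj⟩

theorem sum_card_commonNbrs (r : ℕ) {n : ℕ} (G : SimpleGraph (Fin n)) [DecidableRel G.Adj] :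
    ∑ R ∈ univ.powersetCard r, (commonNbrs G R).card = ∑ v, (G.degree v).choose r := by
  simp only [commonNbrs, card_filter]
  rw [sum_comm]
  refine sum_congr rfl fun v _ => ?_
  rw [← card_filter, ← G.card_neighborFinset_eq_degree, ← card_powersetCard]
  congr 1
  ext R
  simp only [mem_filter, mem_powersetCard, subset_iff, mem_univ, implies_true, true_and,
    SimpleGraph.mem_neighborFinset, G.adj_comm v]
  exact and_comm

theorem sum_choose_degree_le (r t : ℕ) (ht : 1 ≤ t) {n : ℕ}
    (G : SimpleGraph (Fin n)) [DecidableRel G.Adj] :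
    ∑ v, (G.degree v).choose r ≤ ktCopies r t G + t * n.choose r := by
  rw [← sum_card_commonNbrs, ktCopies_eq_sum_choose]
  calc _ ≤ ∑ R ∈ univ.powersetCard r, ((commonNbrs G R).card.choose t + t) :=
        sum_le_sum fun R _ => sub_le_choose _ _ ht
    _ = _ := by simp [sum_add_distrib, mul_comm]

/-- A power-mean lower bound for the number of `r`-stars. -/
theorem pow_le_sum_choose_degree (k : ℕ) {n : ℕ} (G : SimpleGraph (Fin n))
    [DecidableRel G.Adj] (x : ℝ) (hx : 0 ≤ x)
    (h : x + k * n ≤ 2 * (G.edgeFinset.card : ℝ)) :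
    x ^ (k + 1) ≤ n ^ k * ((k + 1).factorial * ∑ v, ((G.degree v).choose (k + 1) : ℝ)) := by
  have hsum : (∑ v, (G.degree v : ℝ)) = 2 * (G.edgeFinset.card : ℝ) := by
    exact_mod_cast G.sum_degrees_eq_twice_card_edges
  have hx' : x ≤ ∑ v, ((G.degree v - k : ℕ) : ℝ) := by
    have : ∑ v, (G.degree v : ℝ) ≤ ∑ v, (((G.degree v - k : ℕ) : ℝ) + k) :=
      sum_le_sum fun v _ => by
        have : G.degree v ≤ G.degree v - k + k := by omega
        exact_mod_cast this
    rw [sum_add_distrib, hsum] at this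
    simp only [sum_const, card_univ, Fintype.card_fin, nsmul_eq_mul] at this
    linarith
  calc x ^ (k + 1) ≤ (∑ v, ((G.degree v - k : ℕ) : ℝ)) ^ (k + 1) := by gcongr
    _ ≤ (n : ℝ) ^ k * ∑ v, ((G.degree v - k : ℕ) : ℝ) ^ (k + 1) := by
        simpa using pow_sum_le_card_mul_sum_pow (s := univ)
          (f := fun v => ((G.degree v - k : ℕ) : ℝ)) (fun _ _ => Nat.cast_nonneg _) k
    _ ≤ _ := by
        refine mul_le_mul_of_nonneg_left ?_ (by positivity)
        rw [mul_sum]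
        refine sum_le_sum fun v _ => ?_
        have := Nat.pow_sub_le_descFactorial (G.degree v) (k + 1)
        rw [Nat.descFactorial_eq_factorial_mul_choose, Nat.add_sub_add_right] at this
        exact_mod_cast this

/-- **Erdős–Simonovits supersaturation for complete bipartite graphs.**
For positive integers `r ≤ t` and `γ > 0` there is a constant `c = c_{r,t}(γ)` such
that every graph on `n` vertices with more than `c · n^{2 - 1/r}` edges contains at
least `γ · C(n,r)` copies of `K_{r,t}`.  (Copies are unordered; since `ktCopies`
counts ordered pairs, for `r = t` having at least `γ · C(n,r)` unordered copies is
equivalent to `ktCopies ≥ 2γ · C(n,r)`.) -/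
theorem supersaturation (r t : ℕ) (hr : 1 ≤ r) (hrt : r ≤ t) (γ : ℝ) (hγ : 0 < γ) :
    ∃ c : ℝ, ∀ (n : ℕ) (G : SimpleGraph (Fin n)) [DecidableRel G.Adj],
      c * (n : ℝ) ^ (2 - 1 / (r : ℝ)) < (G.edgeFinset.card : ℝ) →
      (if r = t then 2 * γ else γ) * (n.choose r : ℝ) ≤ (ktCopies r t G : ℝ) := by
  obtain ⟨k, rfl⟩ : ∃ k, r = k + 1 := ⟨r - 1, by omega⟩
  set Γ : ℝ := if k + 1 = t then 2 * γ else γ with hΓ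
  have hΓ0 : 0 < Γ := by rw [hΓ]; split_ifs <;> linarith
  set F : ℝ := ((k + 1).factorial : ℝ) with hF
  have hF1 : 1 ≤ F := Nat.one_le_cast.2 (Nat.factorial_pos (k + 1))
  set c : ℝ := F * (Γ + t) + (k + 1) with hc
  have hFt : 0 ≤ F * (Γ + t) := by positivity
  have hk : (0 : ℝ) ≤ k := by positivity
  refine ⟨c, fun n G _ h => ?_⟩
  rcases Nat.eq_zero_or_pos n with rfl | hn
  · simp
  have hn1 : (1 : ℝ) ≤ n := by exact_mod_cast hn
  have hn0 : (0 : ℝ) < n := by linarith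
  set y : ℝ := (n : ℝ) ^ (2 - 1 / ((k + 1 : ℕ) : ℝ)) with hy
  have hny : (n : ℝ) ≤ y := by
    calc (n : ℝ) = (n : ℝ) ^ (1 : ℝ) := (Real.rpow_one _).symm
      _ ≤ y := by
        refine Real.rpow_le_rpow_of_exponent_le hn1 ?_
        have : 1 / ((k + 1 : ℕ) : ℝ) ≤ 1 := by
          rw [div_le_one (by positivity)]; push_cast; linarith
        linarith
  have hypow : y ^ (k + 1) = n ^ k * (n : ℝ) ^ (k + 1) := by
    rw [hy, ← Real.rpow_natCast, ← Real.rpow_mul hn0.le, ← pow_add, ← Real.rpow_natCast]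
    congr 1
    push_cast
    field_simp
    ring
  have hstars := pow_le_sum_choose_degree k G (c * y) (by positivity) (by nlinarith)
  rw [mul_pow, hypow, mul_left_comm] at hstars
  have hstars' := le_of_mul_le_mul_left hstars (by positivity)
  have hcpow : c ≤ c ^ (k + 1) := le_self_pow₀ (by linarith) (by omega)
  have hchoose : (n.choose (k + 1) : ℝ) ≤ (n : ℝ) ^ (k + 1) := by
    exact_mod_cast Nat.choose_le_pow n (k + 1)
  have hlow : F * ((Γ + t) * n.choose (k + 1)) ≤
      F * ∑ v, ((G.degree v).choose (k + 1) : ℝ) := by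
    calc _ = F * (Γ + t) * n.choose (k + 1) := by ring
      _ ≤ c ^ (k + 1) * (n : ℝ) ^ (k + 1) := by
        gcongr
        linarith
      _ ≤ _ := hstars'
  have hlow' := le_of_mul_le_mul_left hlow (by linarith)
  have hup : (∑ v, ((G.degree v).choose (k + 1) : ℝ)) ≤
      ktCopies (k + 1) t G + t * n.choose (k + 1) := by
    exact_mod_cast sum_choose_degree_le (k + 1) t (hr.trans hrt) G
  linarith
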